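/- Let P be a countable partial order with no infinite antichain, and let C, D, E be η-maximal chains in P with C ⪯η D and D ⪯η E. If x ∈ C and x ∉ D, then x ∉ E. -/

import Mathlib

/-- A subset of a poset has order type `η` if (with its induced order) it is
order-isomorphic to `ℚ`. -/
def EtaType {α : Type*} [PartialOrder α] (C : Set α) : Prop :=
  Nonempty (C ≃o ℚ)

/-- A chain `C` is `η`-maximal if it has order type `η` and the only chain of
order type `η` containing `C` is `C` itself. -/
def EtaMaximal {α : Type*} [PartialOrder α] (C : Set α) : Prop :=
  IsChain (· ≤ ·) C ∧ EtaType C ∧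
    ∀ D : Set α, IsChain (· ≤ ·) D → EtaType D → C ⊆ D → D = C

/-- `f` witnesses an `η`-replacement from the `η`-maximal chain `C` to the
`η`-maximal chain `C'`. -/
def EtaReplacement {α : Type*} [PartialOrder α] (C C' : Set α) (f : α → Set α) :
    Prop :=
  (∀ x ∈ C, f x ⊆ C') ∧
  (∀ x ∈ C, ∀ w ∈ C', ∀ y ∈ f x, ∀ z ∈ f x, y ≤ w → w ≤ z → w ∈ f x) ∧
  (∀ x ∈ C, ∀ y ∈ C, x ≠ y → Disjoint (f x) (f y)) ∧
  (∀ x ∈ C, ∀ y ∈ C, x < y → ∀ a ∈ f x, ∀ b ∈ f y, a < b) ∧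
  (∀ x ∈ C, f x = {x} ∨ ∃ S ⊆ f x, EtaType S) ∧
  (∀ x ∈ C, ∀ y ∈ C, ∀ z ∈ f y, (x < y → x < z) ∧ (y < x → z < x))

/-- `C ⪯η C'`: there is an `η`-replacement from `C` to `C'`. -/
def EtaPrec {α : Type*} [PartialOrder α] (C C' : Set α) : Prop :=
  ∃ f : α → Set α, EtaReplacement C C' f

section EtaChains

variable {α : Type*} [PartialOrder α]

theorem EtaType.countable {C : Set α} (h : EtaType C) : C.Countable :=
  let ⟨e⟩ := h
  Set.countable_coe_iff.mp e.injective.countable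

theorem EtaType.isChain {C : Set α} (h : EtaType C) : IsChain (· ≤ ·) C := by
  obtain ⟨e⟩ := h
  intro a ha b hb _
  rcases le_total (e ⟨a, ha⟩) (e ⟨b, hb⟩) with h | h
  · exact Or.inl (e.le_iff_le.mp h)
  · exact Or.inr (e.le_iff_le.mp h)

theorem EtaType.nonempty {C : Set α} (h : EtaType C) : C.Nonempty :=
  let ⟨e⟩ := h
  ⟨e.symm 0, (e.symm 0).2⟩

theorem EtaType.exists_gt {C : Set α} (h : EtaType C) {a : α} (ha : a ∈ C) :
    ∃ b ∈ C, a < b := by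
  obtain ⟨e⟩ := h
  obtain ⟨q, hq⟩ := NoMaxOrder.exists_gt (e ⟨a, ha⟩)
  exact ⟨e.symm q, (e.symm q).2, (e.lt_symm_apply.mpr hq : (⟨a, ha⟩ : C) < _)⟩

theorem EtaType.exists_lt {C : Set α} (h : EtaType C) {a : α} (ha : a ∈ C) :
    ∃ b ∈ C, b < a := by
  obtain ⟨e⟩ := h
  obtain ⟨q, hq⟩ := NoMinOrder.exists_lt (e ⟨a, ha⟩)
  exact ⟨e.symm q, (e.symm q).2, (e.symm_apply_lt.mpr hq : _ < (⟨a, ha⟩ : C))⟩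

theorem EtaType.exists_between {C : Set α} (h : EtaType C) {a b : α} (ha : a ∈ C)
    (hb : b ∈ C) (hab : a < b) : ∃ c ∈ C, a < c ∧ c < b := by
  obtain ⟨e⟩ := h
  obtain ⟨q, hq, hq'⟩ := _root_.exists_between
    (e.lt_iff_lt.mpr (show (⟨a, ha⟩ : C) < ⟨b, hb⟩ from hab))
  exact ⟨e.symm q, (e.symm q).2, (e.lt_symm_apply.mpr hq : (⟨a, ha⟩ : C) < _),
    (e.symm_apply_lt.mpr hq' : _ < (⟨b, hb⟩ : C))⟩

/-- Cantor's characterization of the order type `η`, for subsets of a poset. -/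
theorem etaType_of_dense {C : Set α} (hc : C.Countable) (hch : IsChain (· ≤ ·) C)
    (hne : C.Nonempty) (hgt : ∀ a ∈ C, ∃ b ∈ C, a < b) (hlt : ∀ a ∈ C, ∃ b ∈ C, b < a)
    (hbt : ∀ a ∈ C, ∀ b ∈ C, a < b → ∃ c ∈ C, a < c ∧ c < b) : EtaType C := by
  classical
  let _ : LinearOrder C :=
    { (inferInstance : PartialOrder C) with
      le_total := fun a b => hch.total a.2 b.2
      toDecidableLE := Classical.decRel _ }
  have : Countable C := hc.to_subtype
  have : Nonempty C := hne.to_subtype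
  have : NoMaxOrder C := ⟨fun a => let ⟨b, hb, h⟩ := hgt a a.2; ⟨⟨b, hb⟩, h⟩⟩
  have : NoMinOrder C := ⟨fun a => let ⟨b, hb, h⟩ := hlt a a.2; ⟨⟨b, hb⟩, h⟩⟩
  have : DenselyOrdered C :=
    ⟨fun a b hab => let ⟨c, hc, h⟩ := hbt a a.2 b b.2 hab; ⟨⟨c, hc⟩, h⟩⟩
  exact Order.iso_of_countable_dense C ℚ

theorem EtaType.inter_Ioo {S : Set α} (hS : EtaType S) {a b : α} (ha : a ∈ S) (hb : b ∈ S)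
    (hab : a < b) : EtaType (S ∩ Set.Ioo a b) := by
  refine etaType_of_dense (hS.countable.mono Set.inter_subset_left)
    (hS.isChain.mono Set.inter_subset_left) (hS.exists_between ha hb hab) ?_ ?_ ?_
  · rintro u ⟨hu, hau, hub⟩
    obtain ⟨v, hv, huv, hvb⟩ := hS.exists_between hu hb hub
    exact ⟨v, ⟨hv, hau.trans huv, hvb⟩, huv⟩
  · rintro u ⟨hu, hau, hub⟩
    obtain ⟨v, hv, hav, hvu⟩ := hS.exists_between ha hu hau
    exact ⟨v, ⟨hv, hav, hvu.trans hub⟩, hvu⟩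
  · rintro u ⟨hu, hau, hub⟩ v ⟨hv, hav, hvb⟩ huv
    obtain ⟨w, hw, huw, hwv⟩ := hS.exists_between hu hv huv
    exact ⟨w, ⟨hw, hau.trans huw, hwv.trans hvb⟩, huw, hwv⟩

/-- No chain of order type `η` fits into an `η`-maximal chain immediately below or
immediately above one of its points. -/
theorem EtaMaximal.not_insert {C I : Set α} (hC : EtaMaximal C) (hI : EtaType I) {x : α}
    (hx : x ∈ C) (hlow : ∀ y ∈ C, y < x → ∀ w ∈ I, y < w)
    (hupp : ∀ y ∈ C, x < y → ∀ w ∈ I, w < y) :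
    ¬ ((∀ w ∈ I, w < x) ∨ ∀ w ∈ I, x < w) := by
  intro hside
  obtain ⟨hCch, hCeta, hmax⟩ := hC
  have cases_x : ∀ y ∈ C, y < x ∨ y = x ∨ x < y := fun y hy => by
    rcases hCch.total hy hx with h | h
    · exact h.lt_or_eq.imp_right Or.inl
    · exact h.lt_or_eq.elim (fun h => Or.inr (Or.inr h)) (fun h => Or.inr (Or.inl h.symm))
  have side : ∀ y ∈ C, (∀ w ∈ I, y < w) ∨ ∀ w ∈ I, w < y := fun y hy => by
    rcases cases_x y hy with h | rfl | h
    · exact Or.inl (hlow y hy h)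
    · exact hside.symm
    · exact Or.inr (hupp y hy h)
  have hch : IsChain (· ≤ ·) (C ∪ I) := by
    refine isChain_union.mpr ⟨hCch, hI.isChain, fun y hy w hw _ => ?_⟩
    exact (side y hy).imp (fun h => (h w hw).le) (fun h => (h w hw).le)
  have heta : EtaType (C ∪ I) := by
    refine etaType_of_dense (hCeta.countable.union hI.countable) hch ⟨x, Or.inl hx⟩ ?_ ?_ ?_
    · rintro u (hu | hu)
      · obtain ⟨v, hv, h⟩ := hCeta.exists_gt hu
        exact ⟨v, Or.inl hv, h⟩
      · obtain ⟨v, hv, h⟩ := hI.exists_gt hu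
        exact ⟨v, Or.inr hv, h⟩
    · rintro u (hu | hu)
      · obtain ⟨v, hv, h⟩ := hCeta.exists_lt hu
        exact ⟨v, Or.inl hv, h⟩
      · obtain ⟨v, hv, h⟩ := hI.exists_lt hu
        exact ⟨v, Or.inr hv, h⟩
    · rintro u (hu | hu) v (hv | hv) huv
      · obtain ⟨w, hw, h⟩ := hCeta.exists_between hu hv huv
        exact ⟨w, Or.inl hw, h⟩
      · obtain ⟨w, hw, h⟩ := hI.exists_lt hv
        exact ⟨w, Or.inr hw, (side u hu).elim (fun h => h w hw)
          (fun h => (lt_asymm huv (h v hv)).elim), h⟩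
      · obtain ⟨w, hw, h⟩ := hI.exists_gt hu
        exact ⟨w, Or.inr hw, h, (side v hv).elim (fun h => (lt_asymm huv (h u hu)).elim)
          (fun h => h w hw)⟩
      · obtain ⟨w, hw, h⟩ := hI.exists_between hu hv huv
        exact ⟨w, Or.inr hw, h⟩
  have heq : C ∪ I = C := hmax _ hch heta Set.subset_union_left
  obtain ⟨w, hw⟩ := hI.nonempty
  have hwC : w ∈ C := heq ▸ Or.inr hw
  exact (side w hwC).elim (fun h => lt_irrefl w (h w hw)) (fun h => lt_irrefl w (h w hw))

theorem EtaReplacement.nonempty {C C' : Set α} {f : α → Set α} (hf : EtaReplacement C C' f)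
    {x : α} (hx : x ∈ C) : (f x).Nonempty := by
  rcases hf.2.2.2.2.1 x hx with h | ⟨S, hS, hSeta⟩
  · exact h ▸ Set.singleton_nonempty x
  · exact hSeta.nonempty.mono hS

end EtaChains

/-- (Non-recurrence of points under `η`-replacements.)  If `C ⪯η D ⪯η E` are
`η`-maximal chains in a countable FAC poset and `x ∈ C` is not in `D`, then
`x` is not in `E`. -/
theorem eta_non_recurrence (α : Type*) [PartialOrder α] [Countable α]
    (hFAC : ∀ A : Set α, IsAntichain (· ≤ ·) A → A.Finite)
    (C D E : Set α) (hC : EtaMaximal C) (hD : EtaMaximal D) (hE : EtaMaximal E)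
    (hCD : EtaPrec C D) (hDE : EtaPrec D E)
    (x : α) (hxC : x ∈ C) (hxD : x ∉ D) : x ∉ E := by
  intro hxE
  obtain ⟨f, hf⟩ := hCD
  obtain ⟨g, hg⟩ := hDE
  have hfx := hf.1 x hxC
  have hf_cmp := hf.2.2.2.2.2
  have hg_cmp := hg.2.2.2.2.2
  obtain ⟨S, hSf, hS⟩ : ∃ S ⊆ f x, EtaType S :=
    (hf.2.2.2.2.1 x hxC).resolve_left fun h => hxD (hfx (h ▸ Set.mem_singleton x))
  have hSD : S ⊆ D := hSf.trans hfx
  -- The part of `S` between two of its points fits into `C` next to `x`.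
  have key : ∀ a ∈ S, ∀ b ∈ S, a < b → ¬ (b ≤ x ∨ x ≤ a) := by
    intro a ha b hb hab h
    refine hC.not_insert (hS.inter_Ioo ha hb hab) hxC
      (fun y hy hyx w hw => (hf_cmp y hy x hxC w (hSf hw.1)).1 hyx)
      (fun y hy hxy w hw => (hf_cmp y hy x hxC w (hSf hw.1)).2 hxy) ?_
    exact h.imp (fun h w hw => hw.2.2.trans_le h) (fun h w hw => h.trans_lt hw.2.1)
  obtain ⟨s, hs⟩ := hS.nonempty
  obtain ⟨b, hb, hbs⟩ := hS.exists_lt hs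
  obtain ⟨a, ha, hab⟩ := hS.exists_lt hb
  obtain ⟨c, hc, hsc⟩ := hS.exists_gt hs
  obtain ⟨d, hd, hcd⟩ := hS.exists_gt hc
  obtain ⟨z, hz⟩ := hg.nonempty (hSD hs)
  rcases hE.1.total (hg.1 s (hSD hs) hz) hxE with hzx | hxz
  · have hbz := (hg_cmp b (hSD hb) s (hSD hs) z hz).1 hbs
    exact key a ha b hb hab (Or.inl (hbz.le.trans hzx))
  · have hzc := (hg_cmp c (hSD hc) s (hSD hs) z hz).2 hsc
    exact key c hc d hd hcd (Or.inr (hxz.trans hzc.le))
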